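/- Let y and p be real-valued Schwartz functions on ℝ, set z = 4y - y'', and assume p - p'' = (3/2)z² on ℝ. Then ∫_ℝ (z(x) z'(x) + p'(x)) · (y(x) - y''(x)) dx = 0. -/

import Mathlib

open MeasureTheory Filter Topology SchwartzMap

theorem schwartz_mul_aux (f g : SchwartzMap ℝ ℝ) :
    ∃ h : SchwartzMap ℝ ℝ, ∀ x, h x = f x * g x :=
  ⟨SchwartzMap.pairing (ContinuousLinearMap.mul ℝ ℝ) f g, fun x => by simp [SchwartzMap.pairing_apply_apply]⟩

theorem schwartz_deriv_aux (f : SchwartzMap ℝ ℝ) :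
    ∃ h : SchwartzMap ℝ ℝ, deriv ⇑f = ⇑h :=
  ⟨SchwartzMap.derivCLM ℝ ℝ f, by ext x; simp⟩

/-- For real Schwartz functions `y`, `p` with `z = 4y - y''` and
`p - p'' = (3/2) z²`, one has `∫ (z z' + p')(y - y'') = 0`. -/
theorem stmt_8 (y p : SchwartzMap ℝ ℝ)
    (hp : ∀ x, p x - deriv (deriv ⇑p) x
        = (3/2) * (4 * y x - deriv (deriv ⇑y) x) ^ 2) :
    (∫ x, ((4 * y x - deriv (deriv ⇑y) x)
          * deriv (fun t => 4 * y t - deriv (deriv ⇑y) t) x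
        + deriv ⇑p x) * (y x - deriv (deriv ⇑y) x)) = 0 := by
  obtain ⟨y1, hy1⟩ := schwartz_deriv_aux y
  obtain ⟨y2, hy2⟩ := schwartz_deriv_aux y1
  obtain ⟨y3, hy3⟩ := schwartz_deriv_aux y2
  obtain ⟨p1, hp1⟩ := schwartz_deriv_aux p
  obtain ⟨p2, hp2⟩ := schwartz_deriv_aux p1
  obtain ⟨p3, hp3⟩ := schwartz_deriv_aux p2
  simp only [hy1, hy2, hp1, hp2] at hp ⊢
  have dy : ∀ x, HasDerivAt y (y1 x) x := fun x => hy1 ▸ y.hasDerivAt x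
  have dy1 : ∀ x, HasDerivAt y1 (y2 x) x := fun x => hy2 ▸ y1.hasDerivAt x
  have dy2 : ∀ x, HasDerivAt y2 (y3 x) x := fun x => hy3 ▸ y2.hasDerivAt x
  have dp : ∀ x, HasDerivAt p (p1 x) x := fun x => hp1 ▸ p.hasDerivAt x
  have dp1 : ∀ x, HasDerivAt p1 (p2 x) x := fun x => hp2 ▸ p1.hasDerivAt x
  have dp2 : ∀ x, HasDerivAt p2 (p3 x) x := fun x => hp3 ▸ p2.hasDerivAt x
  have dz : ∀ x, HasDerivAt (fun t => 4 * y t - y2 t) (4 * y1 x - y3 x) x :=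
    fun x => ((dy x).const_mul 4).sub (dy2 x)
  have key : ∀ x, p1 x - p3 x = 3 * (4 * y x - y2 x) * (4 * y1 x - y3 x) := by
    intro x
    have h1 : HasDerivAt (fun t => p t - p2 t) (p1 x - p3 x) x := (dp x).sub (dp2 x)
    have h2 := ((dz x).pow 2).const_mul (3/2 : ℝ)
    have h3 := h1.unique (h2.congr_of_eventuallyEq (Eventually.of_forall hp))
    rw [h3]; norm_num; ring
  obtain ⟨a, ha⟩ := schwartz_mul_aux p2 y
  obtain ⟨b, hb⟩ := schwartz_mul_aux p1 y1
  obtain ⟨c, hc⟩ := schwartz_mul_aux ((4:ℝ) • y - y2) ((4:ℝ) • y - y2)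
  obtain ⟨d, hd⟩ := schwartz_mul_aux c ((4:ℝ) • y - y2)
  let F : SchwartzMap ℝ ℝ := a - b + (1/3:ℝ) • d
  obtain ⟨F1, hF1⟩ := schwartz_deriv_aux F
  have dF : ∀ x, HasDerivAt F (F1 x) x := fun x => hF1 ▸ F.hasDerivAt x
  have hF : ∀ x, F x = p2 x * y x - p1 x * y1 x + (1/3) * (4 * y x - y2 x) ^ 3 := by
    intro x
    simp [F, ha, hb, hc, hd]
    ring
  have e : ∀ x, ((4 * y x - y2 x) * deriv (fun t => 4 * y t - y2 t) x + p1 x) * (y x - y2 x)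
      = F1 x := by
    intro x
    rw [(dz x).deriv]
    have h2 := (((dp2 x).mul (dy x)).sub ((dp1 x).mul (dy1 x))).add
      (((dz x).pow 3).const_mul (1/3 : ℝ))
    have h3 := (dF x).unique (h2.congr_of_eventuallyEq (Eventually.of_forall hF))
    rw [h3]
    norm_num
    linear_combination (y x) * key x
  simp only [e]
  exact integral_eq_zero_of_hasDerivAt_of_integrable dF F1.integrable F.integrable
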